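/- (Corollary 3.5(i)) The inversion maps flat points into umbilic points: if at a point (u₀,v₀) all second fundamental form coefficients of x vanish, e = f = g = 0, then the inverse patch y is umbilic at (u₀,v₀); namely ẽ = μẼ, f̃ = μF̃, g̃ = μG̃ there, with μ = −2η/r². -/

import Mathlib

noncomputable section
open scoped RealInnerProductSpace

/-- ℝ³ as Euclidean 3-space. -/
abbrev E3 : Type := EuclideanSpace ℝ (Fin 3)

/-- The cross product on ℝ³. -/
def cross (a b : E3) : E3 :=
  (WithLp.equiv 2 (Fin 3 → ℝ)).symm
    ![a 1 * b 2 - a 2 * b 1, a 2 * b 0 - a 0 * b 2, a 0 * b 1 - a 1 * b 0]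

/-- The inversion of ℝ³ with center `c` and radius `r`. -/
def inv3 (c : E3) (r : ℝ) (p : E3) : E3 :=
  c + (r ^ 2 / ‖p - c‖ ^ 2) • (p - c)

/-- Partial derivative in the first variable. -/
def pu {E : Type*} [NormedAddCommGroup E] [NormedSpace ℝ E]
    (x : ℝ → ℝ → E) (u v : ℝ) : E :=
  deriv (fun t => x t v) u

/-- Partial derivative in the second variable. -/
def pv {E : Type*} [NormedAddCommGroup E] [NormedSpace ℝ E]
    (x : ℝ → ℝ → E) (u v : ℝ) : E :=
  deriv (fun t => x u t) v

/-- The unit normal of a patch. -/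
def unormal (x : ℝ → ℝ → E3) (u v : ℝ) : E3 :=
  ‖cross (pu x u v) (pv x u v)‖⁻¹ • cross (pu x u v) (pv x u v)

/-- The conformal factor λ of the inversion along the patch. -/
def lam (c : E3) (r : ℝ) (x : ℝ → ℝ → E3) (u v : ℝ) : ℝ :=
  r ^ 2 / ‖x u v - c‖ ^ 2

/-- The support-type function η = ⟨U_x, x − c⟩. -/
def eta (c : E3) (x : ℝ → ℝ → E3) (u v : ℝ) : ℝ :=
  ⟪unormal x u v, x u v - c⟫

/-- First fundamental form coefficient E. -/
def FFE (x : ℝ → ℝ → E3) (u v : ℝ) : ℝ := ⟪pu x u v, pu x u v⟫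
/-- First fundamental form coefficient F. -/
def FFF (x : ℝ → ℝ → E3) (u v : ℝ) : ℝ := ⟪pu x u v, pv x u v⟫
/-- First fundamental form coefficient G. -/
def FFG (x : ℝ → ℝ → E3) (u v : ℝ) : ℝ := ⟪pv x u v, pv x u v⟫
/-- Second fundamental form coefficient e. -/
def SFe (x : ℝ → ℝ → E3) (u v : ℝ) : ℝ := ⟪pu (pu x) u v, unormal x u v⟫
/-- Second fundamental form coefficient f. -/
def SFf (x : ℝ → ℝ → E3) (u v : ℝ) : ℝ := ⟪pv (pu x) u v, unormal x u v⟫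
/-- Second fundamental form coefficient g. -/
def SFg (x : ℝ → ℝ → E3) (u v : ℝ) : ℝ := ⟪pv (pv x) u v, unormal x u v⟫
/-- Third fundamental form coefficient P. -/
def TFP (x : ℝ → ℝ → E3) (u v : ℝ) : ℝ := ⟪pu (unormal x) u v, pu (unormal x) u v⟫
/-- Third fundamental form coefficient Q. -/
def TFQ (x : ℝ → ℝ → E3) (u v : ℝ) : ℝ := ⟪pu (unormal x) u v, pv (unormal x) u v⟫
/-- Third fundamental form coefficient R. -/
def TFR (x : ℝ → ℝ → E3) (u v : ℝ) : ℝ := ⟪pv (unormal x) u v, pv (unormal x) u v⟫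

/-- Christoffel symbol Γ¹₁₁. -/
def Ch111 (x : ℝ → ℝ → E3) (u v : ℝ) : ℝ :=
  (FFG x u v * pu (FFE x) u v - 2 * FFF x u v * pu (FFF x) u v + FFF x u v * pv (FFE x) u v) /
    (2 * (FFE x u v * FFG x u v - FFF x u v ^ 2))
/-- Christoffel symbol Γ²₁₁. -/
def Ch211 (x : ℝ → ℝ → E3) (u v : ℝ) : ℝ :=
  (2 * FFE x u v * pu (FFF x) u v - FFE x u v * pv (FFE x) u v - FFF x u v * pu (FFE x) u v) /
    (2 * (FFE x u v * FFG x u v - FFF x u v ^ 2))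
/-- Christoffel symbol Γ¹₁₂. -/
def Ch112 (x : ℝ → ℝ → E3) (u v : ℝ) : ℝ :=
  (FFG x u v * pv (FFE x) u v - FFF x u v * pu (FFG x) u v) /
    (2 * (FFE x u v * FFG x u v - FFF x u v ^ 2))
/-- Christoffel symbol Γ²₁₂. -/
def Ch212 (x : ℝ → ℝ → E3) (u v : ℝ) : ℝ :=
  (FFE x u v * pu (FFG x) u v - FFF x u v * pv (FFE x) u v) /
    (2 * (FFE x u v * FFG x u v - FFF x u v ^ 2))
/-- Christoffel symbol Γ¹₂₂. -/
def Ch122 (x : ℝ → ℝ → E3) (u v : ℝ) : ℝ :=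
  (2 * FFG x u v * pv (FFF x) u v - FFG x u v * pu (FFG x) u v - FFF x u v * pv (FFG x) u v) /
    (2 * (FFE x u v * FFG x u v - FFF x u v ^ 2))
/-- Christoffel symbol Γ²₂₂. -/
def Ch222 (x : ℝ → ℝ → E3) (u v : ℝ) : ℝ :=
  (FFE x u v * pv (FFG x) u v - 2 * FFF x u v * pv (FFF x) u v + FFF x u v * pu (FFG x) u v) /
    (2 * (FFE x u v * FFG x u v - FFF x u v ^ 2))

/-- The tangent map of the inversion at `p`. -/
def phiStar (c : E3) (r : ℝ) (p : E3) (w : E3) : E3 :=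
  (r ^ 2 / ‖p - c‖ ^ 2) • w - (2 * r ^ 2 * ⟪p - c, w⟫ / ‖p - c‖ ^ 4) • (p - c)

/-- The conformal factor of the inversion differentiates along a curve. -/
lemma hasDerivAt_conformal_factor {c : E3} (r : ℝ) {g : ℝ → E3} {g' : E3} {t : ℝ}
    (hg : HasDerivAt g g' t) (hc : g t ≠ c) :
    HasDerivAt (fun s => r ^ 2 / ‖g s - c‖ ^ 2)
      (-(2 * r ^ 2 * ⟪g t - c, g'⟫ / ‖g t - c‖ ^ 4)) t := by
  have hn : ‖g t - c‖ ≠ 0 := norm_ne_zero_iff.2 (sub_ne_zero.2 hc)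
  have h := (hasDerivAt_const t (r ^ 2)).div ((hg.sub_const c).norm_sq) (pow_ne_zero 2 hn)
  refine h.congr_deriv ?_
  field_simp
  ring

lemma hasDerivAt_inv3_comp {c : E3} (r : ℝ) {g : ℝ → E3} {g' : E3} {t : ℝ}
    (hg : HasDerivAt g g' t) (hc : g t ≠ c) :
    HasDerivAt (fun s => inv3 c r (g s)) (phiStar c r (g t) g') t := by
  have h := ((hasDerivAt_conformal_factor r hg hc).smul (hg.sub_const c)).const_add c
  refine h.congr_deriv ?_
  simp only [phiStar]
  module

lemma hasDerivAt_phiStar_comp {c : E3} (r : ℝ) {g w : ℝ → E3} {g' w' : E3} {t : ℝ}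
    (hg : HasDerivAt g g' t) (hw : HasDerivAt w w' t) (hc : g t ≠ c) :
    HasDerivAt (fun s => phiStar c r (g s) (w s))
      (phiStar c r (g t) w' - (2 * r ^ 2 * ⟪g t - c, g'⟫ / ‖g t - c‖ ^ 4) • w t
        - (2 * r ^ 2 * ⟪g t - c, w t⟫ / ‖g t - c‖ ^ 4) • g'
        - (2 * r ^ 2 * ⟪g', w t⟫ / ‖g t - c‖ ^ 4
          - 8 * r ^ 2 * ⟪g t - c, w t⟫ * ⟪g t - c, g'⟫ / ‖g t - c‖ ^ 6) • (g t - c)) t := by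
  have hn : ‖g t - c‖ ≠ 0 := norm_ne_zero_iff.2 (sub_ne_zero.2 hc)
  have hd := hg.sub_const c
  have hden : HasDerivAt (fun s => ‖g s - c‖ ^ 4) (4 * ‖g t - c‖ ^ 2 * ⟪g t - c, g'⟫) t := by
    have h := hd.norm_sq.pow 2
    refine (h.congr_deriv ?_).congr_of_eventuallyEq (.of_forall fun s => ?_)
    · simp; ring
    · simp only [Pi.pow_apply]; ring
  have hcoef := ((hd.inner ℝ hw).const_mul (2 * r ^ 2)).div hden (pow_ne_zero 4 hn)
  have h := ((hasDerivAt_conformal_factor r hg hc).smul hw).sub (hcoef.smul hd)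
  refine h.congr_deriv ?_
  simp only [phiStar, Pi.div_apply]
  match_scalars <;> field_simp <;> ring

/-- The tangent map of the inversion is conformal. -/
lemma inner_phiStar_phiStar {c p : E3} (r : ℝ) (hp : p ≠ c) (a b : E3) :
    ⟪phiStar c r p a, phiStar c r p b⟫ = (r ^ 2 / ‖p - c‖ ^ 2) ^ 2 * ⟪a, b⟫ := by
  have hn : ‖p - c‖ ≠ 0 := norm_ne_zero_iff.2 (sub_ne_zero.2 hp)
  simp only [phiStar]
  generalize p - c = d at *
  simp only [inner_sub_left, inner_sub_right, real_inner_smul_left,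
    real_inner_smul_right, real_inner_self_eq_norm_sq, real_inner_comm d a]
  field_simp
  ring

lemma norm_phiStar {c p : E3} (r : ℝ) (hp : p ≠ c) (a : E3) :
    ‖phiStar c r p a‖ = r ^ 2 / ‖p - c‖ ^ 2 * ‖a‖ := by
  rw [← sq_eq_sq₀ (norm_nonneg _) (by positivity), ← real_inner_self_eq_norm_sq,
    inner_phiStar_phiStar r hp, real_inner_self_eq_norm_sq, mul_pow]

/-- The tangent map of the inversion reverses orientation. -/
lemma cross_phiStar_phiStar {c p : E3} (r : ℝ) (hp : p ≠ c) (a b : E3) :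
    cross (phiStar c r p a) (phiStar c r p b)
      = -((r ^ 2 / ‖p - c‖ ^ 2) • phiStar c r p (cross a b)) := by
  have hn : ‖p - c‖ ≠ 0 := norm_ne_zero_iff.2 (sub_ne_zero.2 hp)
  obtain ⟨d, hd⟩ : ∃ d, d = p - c := ⟨_, rfl⟩
  have hsq : ‖d‖ ^ 2 = d 0 ^ 2 + d 1 ^ 2 + d 2 ^ 2 := by
    rw [EuclideanSpace.real_norm_sq_eq, Fin.sum_univ_three]
  have h4 : ‖d‖ ^ 4 = (‖d‖ ^ 2) ^ 2 := by ring
  rw [← hd] at hn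
  have hs : d 0 ^ 2 + d 1 ^ 2 + d 2 ^ 2 ≠ 0 := hsq ▸ pow_ne_zero 2 hn
  simp only [phiStar, ← hd, h4, hsq]
  ext i
  fin_cases i <;>
  · simp [cross, PiLp.inner_apply, Fin.sum_univ_three]
    field_simp
    ring

lemma inner_cross_left (a b : E3) : ⟪a, cross a b⟫ = 0 := by
  simp [cross, PiLp.inner_apply, Fin.sum_univ_three]
  ring

lemma inner_cross_right (a b : E3) : ⟪b, cross a b⟫ = 0 := by
  simp [cross, PiLp.inner_apply, Fin.sum_univ_three]
  ring

lemma inner_pu_unormal (x : ℝ → ℝ → E3) (u v : ℝ) : ⟪pu x u v, unormal x u v⟫ = 0 := by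
  rw [unormal, real_inner_smul_right, inner_cross_left, mul_zero]

lemma inner_pv_unormal (x : ℝ → ℝ → E3) (u v : ℝ) : ⟪pv x u v, unormal x u v⟫ = 0 := by
  rw [unormal, real_inner_smul_right, inner_cross_right, mul_zero]

/-- The second fundamental form of the inverse patch, in terms of the tangent vectors `a`, `b` and
the second derivative `w` of the original patch, at a point where `w` is tangent. -/
lemma inner_deriv_phiStar_normal {c p : E3} {r : ℝ} (hr : r ≠ 0) (hp : p ≠ c) {a b w n : E3}
    (ha : ⟪a, n⟫ = 0) (hb : ⟪b, n⟫ = 0) (hw : ⟪w, n⟫ = 0) :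
    ⟪phiStar c r p w - (2 * r ^ 2 * ⟪p - c, b⟫ / ‖p - c‖ ^ 4) • a
        - (2 * r ^ 2 * ⟪p - c, a⟫ / ‖p - c‖ ^ 4) • b
        - (2 * r ^ 2 * ⟪b, a⟫ / ‖p - c‖ ^ 4
          - 8 * r ^ 2 * ⟪p - c, a⟫ * ⟪p - c, b⟫ / ‖p - c‖ ^ 6) • (p - c),
      -((r ^ 2 / ‖p - c‖ ^ 2)⁻¹ • phiStar c r p n)⟫
      = (-2 * ⟪n, p - c⟫ / r ^ 2) * ⟪phiStar c r p a, phiStar c r p b⟫ := by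
  have hn : ‖p - c‖ ≠ 0 := norm_ne_zero_iff.2 (sub_ne_zero.2 hp)
  rw [inner_phiStar_phiStar r hp]
  simp only [phiStar]
  generalize p - c = d at *
  simp only [inner_sub_left, inner_sub_right, inner_neg_right, real_inner_smul_left,
    real_inner_smul_right, real_inner_self_eq_norm_sq, ha, hb, hw,
    real_inner_comm d n, real_inner_comm d a, real_inner_comm d b,
    real_inner_comm d w, real_inner_comm a b]
  field_simp
  ring

section Patch

variable {x : ℝ → ℝ → E3}

lemma hasDerivAt_pu (hx : Differentiable ℝ (fun p : ℝ × ℝ => x p.1 p.2)) (u v : ℝ) :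
    HasDerivAt (fun t => x t v) (pu x u v) u :=
  (DifferentiableAt.hasDerivAt <|
    (hx (u, v)).comp u (f := fun t : ℝ => (t, v)) (by fun_prop))

lemma hasDerivAt_pv (hx : Differentiable ℝ (fun p : ℝ × ℝ => x p.1 p.2)) (u v : ℝ) :
    HasDerivAt (fun t => x u t) (pv x u v) v :=
  (DifferentiableAt.hasDerivAt <|
    (hx (u, v)).comp v (f := fun t : ℝ => (u, t)) (by fun_prop))

lemma differentiable_pu (hx : ContDiff ℝ 2 (fun p : ℝ × ℝ => x p.1 p.2)) :
    Differentiable ℝ (fun p : ℝ × ℝ => pu x p.1 p.2) := by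
  have h : (fun p : ℝ × ℝ => pu x p.1 p.2)
      = fun p => fderiv ℝ (fun p : ℝ × ℝ => x p.1 p.2) p (1, 0) := by
    funext p
    have hd := (hx.differentiable two_ne_zero p).hasFDerivAt
    exact (hd.comp_hasDerivAt p.1 (f := fun t : ℝ => (t, p.2))
      ((hasDerivAt_id p.1).prodMk (hasDerivAt_const p.1 p.2))).deriv
  rw [h]
  exact ((hx.fderiv_right (m := 1) (by norm_num)).clm_apply contDiff_const).differentiable
    one_ne_zero

lemma differentiable_pv (hx : ContDiff ℝ 2 (fun p : ℝ × ℝ => x p.1 p.2)) :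
    Differentiable ℝ (fun p : ℝ × ℝ => pv x p.1 p.2) := by
  have h : (fun p : ℝ × ℝ => pv x p.1 p.2)
      = fun p => fderiv ℝ (fun p : ℝ × ℝ => x p.1 p.2) p (0, 1) := by
    funext p
    have hd := (hx.differentiable two_ne_zero p).hasFDerivAt
    exact (hd.comp_hasDerivAt p.2 (f := fun t : ℝ => (p.1, t))
      ((hasDerivAt_const p.2 p.1).prodMk (hasDerivAt_id p.2))).deriv
  rw [h]
  exact ((hx.fderiv_right (m := 1) (by norm_num)).clm_apply contDiff_const).differentiable
    one_ne_zero

end Patch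

theorem inversion_maps_flat_points_to_umbilic_points
    (c : E3) (r : ℝ) (hr : 0 < r)
    (x : ℝ → ℝ → E3)
    (hx : ContDiff ℝ (⊤ : ℕ∞) (fun p : ℝ × ℝ => x p.1 p.2))
    (hxc : ∀ u v : ℝ, x u v ≠ c)
    (y : ℝ → ℝ → E3) (hy : ∀ u v : ℝ, y u v = inv3 c r (x u v))
    (hreg : ∀ u v : ℝ, cross (pu x u v) (pv x u v) ≠ 0)
    (u₀ v₀ : ℝ)
    (he : SFe x u₀ v₀ = 0) (hf : SFf x u₀ v₀ = 0) (hg : SFg x u₀ v₀ = 0) :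
    SFe y u₀ v₀ = (-2 * eta c x u₀ v₀ / r ^ 2) * FFE y u₀ v₀ ∧
    SFf y u₀ v₀ = (-2 * eta c x u₀ v₀ / r ^ 2) * FFF y u₀ v₀ ∧
    SFg y u₀ v₀ = (-2 * eta c x u₀ v₀ / r ^ 2) * FFG y u₀ v₀ := by
  obtain rfl : y = fun u v => inv3 c r (x u v) := by
    funext u v
    exact hy u v
  have hx2 : ContDiff ℝ 2 (fun p : ℝ × ℝ => x p.1 p.2) := contDiff_infty.1 hx 2
  have hx1 := hx2.differentiable two_ne_zero
  have hyu : pu (fun u v => inv3 c r (x u v)) = fun u v => phiStar c r (x u v) (pu x u v) := by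
    funext u v
    exact (hasDerivAt_inv3_comp r (hasDerivAt_pu hx1 u v) (hxc u v)).deriv
  have hyv : pv (fun u v => inv3 c r (x u v)) = fun u v => phiStar c r (x u v) (pv x u v) := by
    funext u v
    exact (hasDerivAt_inv3_comp r (hasDerivAt_pv hx1 u v) (hxc u v)).deriv
  have hp := hxc u₀ v₀
  have hU : unormal (fun u v => inv3 c r (x u v)) u₀ v₀
      = -((r ^ 2 / ‖x u₀ v₀ - c‖ ^ 2)⁻¹ • phiStar c r (x u₀ v₀) (unormal x u₀ v₀)) := by
    have hn : ‖x u₀ v₀ - c‖ ≠ 0 := norm_ne_zero_iff.2 (sub_ne_zero.2 hp)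
    have hN : ‖cross (pu x u₀ v₀) (pv x u₀ v₀)‖ ≠ 0 := norm_ne_zero_iff.2 (hreg u₀ v₀)
    simp only [unormal, hyu, hyv]
    rw [cross_phiStar_phiStar r hp, norm_neg, norm_smul, norm_phiStar r hp,
      Real.norm_of_nonneg (by positivity)]
    simp only [phiStar, real_inner_smul_right]
    match_scalars <;> field_simp
  have huu := (hasDerivAt_phiStar_comp r (hasDerivAt_pu hx1 u₀ v₀)
    (hasDerivAt_pu (differentiable_pu hx2) u₀ v₀) hp).deriv
  have huv := (hasDerivAt_phiStar_comp r (hasDerivAt_pv hx1 u₀ v₀)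
    (hasDerivAt_pv (differentiable_pu hx2) u₀ v₀) hp).deriv
  have hvv := (hasDerivAt_phiStar_comp r (hasDerivAt_pv hx1 u₀ v₀)
    (hasDerivAt_pv (differentiable_pv hx2) u₀ v₀) hp).deriv
  have hu := inner_pu_unormal x u₀ v₀
  have hv := inner_pv_unormal x u₀ v₀
  refine ⟨?_, ?_, ?_⟩
  · rw [SFe, FFE, hU, hyu]
    exact (congrArg (⟪·, _⟫) huu).trans (inner_deriv_phiStar_normal hr.ne' hp hu hu he)
  · rw [SFf, FFF, hU, hyu, hyv]
    exact (congrArg (⟪·, _⟫) huv).trans (inner_deriv_phiStar_normal hr.ne' hp hu hv hf)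
  · rw [SFg, FFG, hU, hyv]
    exact (congrArg (⟪·, _⟫) hvv).trans (inner_deriv_phiStar_normal hr.ne' hp hv hv hg)
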